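/- Let V := {(1+i)·(m + n·i) : m, n ∈ ℤ} ⊆ ℂ and let M := (V + (1+i)/2) ∪ (V + (1−i)/2). Suppose K : ℂ → ℂ is s-holomorphic, i.e., for every point x in one of the four corner sets V+1/2, V−1/2, V+i/2, V−i/2 and every z ∈ M with |z − x| = 1/2, one has K(x) = (1/2)·(K(z) + σ(x)·conj(K(z))), where σ(x) = 1, −1, −i, i according as x lies in V+1/2, V−1/2, V+i/2, V−i/2 respectively. Then the restriction of K to each of V+1/2 and V−1/2 is discrete harmonic: for every x ∈ V+1/2 (and likewise for every x ∈ V−1/2), K(x+1+i) + K(x+1−i) + K(x−1+i) + K(x−1−i) = 4·K(x). -/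

import Mathlib

/-- The rotated square lattice `V = (1+i)·ℤ[i]` of mesh `√2` (vertices at mesh size 1). -/
def latticeV : Set ℂ := {z | ∃ m n : ℤ, z = (1 + Complex.I) * ((m : ℂ) + (n : ℂ) * Complex.I)}

/-- The medial vertices: midpoints `V + (1+i)/2` and `V + (1−i)/2` of the lattice edges. -/
def latticeM : Set ℂ :=
  {z | z - (1 + Complex.I) / 2 ∈ latticeV ∨ z - (1 - Complex.I) / 2 ∈ latticeV}

/-- The s-holomorphicity hypothesis of the main theorem, as a predicate. -/
def SHolomorphic (K : ℂ → ℂ) : Prop :=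
    ∀ x σ : ℂ,
      ((x - 1 / 2 ∈ latticeV ∧ σ = 1) ∨ (x + 1 / 2 ∈ latticeV ∧ σ = -1) ∨
        (x - Complex.I / 2 ∈ latticeV ∧ σ = -Complex.I) ∨
        (x + Complex.I / 2 ∈ latticeV ∧ σ = Complex.I)) →
      ∀ z ∈ latticeM, ‖z - x‖ = 1 / 2 →
        K x = (1 / 2) * (K z + σ * (starRingEnd ℂ) (K z))

theorem latticeV_shift {v w : ℂ} (hv : v ∈ latticeV) (a b : ℤ)
    (h : w = v + (1 + Complex.I) * ((a : ℂ) + (b : ℂ) * Complex.I)) : w ∈ latticeV := by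
  obtain ⟨m, n, rfl⟩ := hv
  refine ⟨m + a, n + b, ?_⟩
  rw [h]; push_cast; ring

theorem medial_mem {v z : ℂ} (hv : v ∈ latticeV)
    (h : z = v + 1 / 2 + Complex.I / 2 ∨ z = v + 1 / 2 - Complex.I / 2 ∨
      z = v - 1 / 2 + Complex.I / 2 ∨ z = v - 1 / 2 - Complex.I / 2) : z ∈ latticeM := by
  have hI := Complex.I_mul_I
  rcases h with rfl | rfl | rfl | rfl
  · left; exact latticeV_shift hv 0 0 (by push_cast; ring)
  · right; exact latticeV_shift hv 0 0 (by push_cast; ring)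
  · right; exact latticeV_shift hv 0 1 (by push_cast; linear_combination -hI)
  · left; exact latticeV_shift hv (-1) 0 (by push_cast; ring)

theorem norm_half {w : ℂ} (h : w = 1 / 2 ∨ w = -(1 / 2) ∨ w = Complex.I / 2 ∨
    w = -(Complex.I / 2)) : ‖w‖ = 1 / 2 := by
  rcases h with rfl | rfl | rfl | rfl <;> simp

theorem corner_one (K : ℂ → ℂ)
    (hK : SHolomorphic K)
    (v x z : ℂ) (hv : v ∈ latticeV) (hx : x = v + 1 / 2)
    (hz : z = x + Complex.I / 2 ∨ z = x - Complex.I / 2) :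
    (K x).re = (K z).re ∧ (K x).im = 0 := by
  have hm : z ∈ latticeM := by
    apply medial_mem hv
    subst hx
    rcases hz with rfl | rfl
    · left; ring
    · right; left; ring
  have hn : ‖z - x‖ = 1 / 2 := by
    apply norm_half
    rcases hz with rfl | rfl
    · right; right; left; ring
    · right; right; right; ring
  have key := hK x _ (Or.inl ⟨by rw [hx]; simpa using hv, rfl⟩) z hm hn
  rw [key]
  constructor <;> simp <;> ring

theorem corner_neg (K : ℂ → ℂ)
    (hK : SHolomorphic K)
    (v x z : ℂ) (hv : v ∈ latticeV) (hx : x = v - 1 / 2)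
    (hz : z = x + Complex.I / 2 ∨ z = x - Complex.I / 2) :
    (K x).re = 0 ∧ (K x).im = (K z).im := by
  have hm : z ∈ latticeM := by
    apply medial_mem hv
    subst hx
    rcases hz with rfl | rfl
    · right; right; left; ring
    · right; right; right; ring
  have hn : ‖z - x‖ = 1 / 2 := by
    apply norm_half
    rcases hz with rfl | rfl
    · right; right; left; ring
    · right; right; right; ring
  have key := hK x _ (Or.inr (Or.inl ⟨by rw [hx]; simpa using hv, rfl⟩)) z hm hn
  rw [key]
  constructor <;> simp <;> ring

theorem corner_up (K : ℂ → ℂ)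
    (hK : SHolomorphic K)
    (v x z : ℂ) (hv : v ∈ latticeV) (hx : x = v + Complex.I / 2)
    (hz : z = x + 1 / 2 ∨ z = x - 1 / 2) :
    (K x).re = ((K z).re - (K z).im) / 2 ∧ (K x).im = ((K z).im - (K z).re) / 2 := by
  have hm : z ∈ latticeM := by
    apply medial_mem hv
    subst hx
    rcases hz with rfl | rfl
    · left; ring
    · right; right; left; ring
  have hn : ‖z - x‖ = 1 / 2 := by
    apply norm_half
    rcases hz with rfl | rfl
    · left; ring
    · right; left; ring
  have key := hK x _ (Or.inr (Or.inr (Or.inl ⟨by rw [hx]; simpa using hv, rfl⟩))) z hm hn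
  rw [key]
  constructor <;> simp <;> ring

theorem corner_down (K : ℂ → ℂ)
    (hK : SHolomorphic K)
    (v x z : ℂ) (hv : v ∈ latticeV) (hx : x = v - Complex.I / 2)
    (hz : z = x + 1 / 2 ∨ z = x - 1 / 2) :
    (K x).re = ((K z).re + (K z).im) / 2 ∧ (K x).im = ((K z).re + (K z).im) / 2 := by
  have hm : z ∈ latticeM := by
    apply medial_mem hv
    subst hx
    rcases hz with rfl | rfl
    · right; left; ring
    · right; right; right; ring
  have hn : ‖z - x‖ = 1 / 2 := by
    apply norm_half
    rcases hz with rfl | rfl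
    · left; ring
    · right; left; ring
  have key := hK x _ (Or.inr (Or.inr (Or.inr ⟨by rw [hx]; simpa using hv, rfl⟩))) z hm hn
  rw [key]
  constructor <;> simp <;> ring

theorem sholomorphic_restriction_discrete_harmonic (K : ℂ → ℂ)
    (hK : ∀ x σ : ℂ,
      ((x - 1 / 2 ∈ latticeV ∧ σ = 1) ∨ (x + 1 / 2 ∈ latticeV ∧ σ = -1) ∨
        (x - Complex.I / 2 ∈ latticeV ∧ σ = -Complex.I) ∨
        (x + Complex.I / 2 ∈ latticeV ∧ σ = Complex.I)) →
      ∀ z ∈ latticeM, ‖z - x‖ = 1 / 2 →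
        K x = (1 / 2) * (K z + σ * (starRingEnd ℂ) (K z))) :
    ∀ x : ℂ, (x - 1 / 2 ∈ latticeV ∨ x + 1 / 2 ∈ latticeV) →
      K (x + 1 + Complex.I) + K (x + 1 - Complex.I) + K (x - 1 + Complex.I) +
          K (x - 1 - Complex.I) = 4 * K x := by
  have hI := Complex.I_mul_I
  intro x hx
  rcases hx with hx | hx
  · have hv : x - 1 / 2 ∈ latticeV := hx
    have hv0 : x - 1 / 2 ∈ latticeV := latticeV_shift hv (0) (0) (by push_cast; linear_combination (0) * hI)
    obtain ⟨e1, f1⟩ := corner_one K hK _ (x) (x + Complex.I / 2) hv0 (by ring) (by left; ring)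
    obtain ⟨e2, f2⟩ := corner_one K hK _ (x) (x - Complex.I / 2) hv0 (by ring) (by right; ring)
    have hv1 : x + 3 / 2 ∈ latticeV := latticeV_shift hv (1) (-1) (by push_cast; linear_combination (1) * hI)
    obtain ⟨e3, f3⟩ := corner_neg K hK _ (x + 1) (x + 1 + Complex.I / 2) hv1 (by ring) (by left; ring)
    obtain ⟨e4, f4⟩ := corner_neg K hK _ (x + 1) (x + 1 - Complex.I / 2) hv1 (by ring) (by right; ring)
    obtain ⟨e5, f5⟩ := corner_neg K hK _ (x - 1) (x - 1 + Complex.I / 2) hv0 (by ring) (by left; ring)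
    obtain ⟨e6, f6⟩ := corner_neg K hK _ (x - 1) (x - 1 - Complex.I / 2) hv0 (by ring) (by right; ring)
    have hv2 : x + 1 / 2 + Complex.I ∈ latticeV := latticeV_shift hv (1) (0) (by push_cast; linear_combination (0) * hI)
    obtain ⟨e7, f7⟩ := corner_down K hK _ (x + 1 / 2 + Complex.I / 2) (x + 1 + Complex.I / 2) hv2 (by ring) (by left; ring)
    obtain ⟨e8, f8⟩ := corner_down K hK _ (x + 1 / 2 + Complex.I / 2) (x + Complex.I / 2) hv2 (by ring) (by right; ring)
    have hv3 : x + 1 / 2 - Complex.I ∈ latticeV := latticeV_shift hv (0) (-1) (by push_cast; linear_combination (1) * hI)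
    obtain ⟨e9, f9⟩ := corner_up K hK _ (x + 1 / 2 - Complex.I / 2) (x + 1 - Complex.I / 2) hv3 (by ring) (by left; ring)
    obtain ⟨e10, f10⟩ := corner_up K hK _ (x + 1 / 2 - Complex.I / 2) (x - Complex.I / 2) hv3 (by ring) (by right; ring)
    obtain ⟨e11, f11⟩ := corner_up K hK _ (x - 1 / 2 + Complex.I / 2) (x + Complex.I / 2) hv0 (by ring) (by left; ring)
    obtain ⟨e12, f12⟩ := corner_up K hK _ (x - 1 / 2 + Complex.I / 2) (x - 1 + Complex.I / 2) hv0 (by ring) (by right; ring)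
    obtain ⟨e13, f13⟩ := corner_down K hK _ (x - 1 / 2 - Complex.I / 2) (x - Complex.I / 2) hv0 (by ring) (by left; ring)
    obtain ⟨e14, f14⟩ := corner_down K hK _ (x - 1 / 2 - Complex.I / 2) (x - 1 - Complex.I / 2) hv0 (by ring) (by right; ring)
    obtain ⟨e15, f15⟩ := corner_one K hK _ (x + 1 + Complex.I) (x + 1 + Complex.I / 2) hv2 (by ring) (by right; ring)
    obtain ⟨e16, f16⟩ := corner_one K hK _ (x + 1 - Complex.I) (x + 1 - Complex.I / 2) hv3 (by ring) (by left; ring)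
    have hv4 : x - 3 / 2 + Complex.I ∈ latticeV := latticeV_shift hv (0) (1) (by push_cast; linear_combination (-1) * hI)
    obtain ⟨e17, f17⟩ := corner_one K hK _ (x - 1 + Complex.I) (x - 1 + Complex.I / 2) hv4 (by ring) (by right; ring)
    have hv5 : x - 3 / 2 - Complex.I ∈ latticeV := latticeV_shift hv (-1) (0) (by push_cast; linear_combination (0) * hI)
    obtain ⟨e18, f18⟩ := corner_one K hK _ (x - 1 - Complex.I) (x - 1 - Complex.I / 2) hv5 (by ring) (by left; ring)
    apply Complex.ext
    · simp only [Complex.add_re, Complex.add_im, Complex.mul_re, Complex.mul_im, Complex.re_ofNat, Complex.im_ofNat]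
      linarith
    · simp only [Complex.add_re, Complex.add_im, Complex.mul_re, Complex.mul_im, Complex.re_ofNat, Complex.im_ofNat]
      linarith
  · have hv : x + 1 / 2 ∈ latticeV := hx
    have hv0 : x + 1 / 2 ∈ latticeV := latticeV_shift hv (0) (0) (by push_cast; linear_combination (0) * hI)
    obtain ⟨e1, f1⟩ := corner_neg K hK _ (x) (x + Complex.I / 2) hv0 (by ring) (by left; ring)
    obtain ⟨e2, f2⟩ := corner_neg K hK _ (x) (x - Complex.I / 2) hv0 (by ring) (by right; ring)
    obtain ⟨e3, f3⟩ := corner_one K hK _ (x + 1) (x + 1 + Complex.I / 2) hv0 (by ring) (by left; ring)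
    obtain ⟨e4, f4⟩ := corner_one K hK _ (x + 1) (x + 1 - Complex.I / 2) hv0 (by ring) (by right; ring)
    have hv1 : x - 3 / 2 ∈ latticeV := latticeV_shift hv (-1) (1) (by push_cast; linear_combination (-1) * hI)
    obtain ⟨e5, f5⟩ := corner_one K hK _ (x - 1) (x - 1 + Complex.I / 2) hv1 (by ring) (by left; ring)
    obtain ⟨e6, f6⟩ := corner_one K hK _ (x - 1) (x - 1 - Complex.I / 2) hv1 (by ring) (by right; ring)
    obtain ⟨e7, f7⟩ := corner_up K hK _ (x + 1 / 2 + Complex.I / 2) (x + 1 + Complex.I / 2) hv0 (by ring) (by left; ring)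
    obtain ⟨e8, f8⟩ := corner_up K hK _ (x + 1 / 2 + Complex.I / 2) (x + Complex.I / 2) hv0 (by ring) (by right; ring)
    obtain ⟨e9, f9⟩ := corner_down K hK _ (x + 1 / 2 - Complex.I / 2) (x + 1 - Complex.I / 2) hv0 (by ring) (by left; ring)
    obtain ⟨e10, f10⟩ := corner_down K hK _ (x + 1 / 2 - Complex.I / 2) (x - Complex.I / 2) hv0 (by ring) (by right; ring)
    have hv2 : x - 1 / 2 + Complex.I ∈ latticeV := latticeV_shift hv (0) (1) (by push_cast; linear_combination (-1) * hI)
    obtain ⟨e11, f11⟩ := corner_down K hK _ (x - 1 / 2 + Complex.I / 2) (x + Complex.I / 2) hv2 (by ring) (by left; ring)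
    obtain ⟨e12, f12⟩ := corner_down K hK _ (x - 1 / 2 + Complex.I / 2) (x - 1 + Complex.I / 2) hv2 (by ring) (by right; ring)
    have hv3 : x - 1 / 2 - Complex.I ∈ latticeV := latticeV_shift hv (-1) (0) (by push_cast; linear_combination (0) * hI)
    obtain ⟨e13, f13⟩ := corner_up K hK _ (x - 1 / 2 - Complex.I / 2) (x - Complex.I / 2) hv3 (by ring) (by left; ring)
    obtain ⟨e14, f14⟩ := corner_up K hK _ (x - 1 / 2 - Complex.I / 2) (x - 1 - Complex.I / 2) hv3 (by ring) (by right; ring)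
    have hv4 : x + 3 / 2 + Complex.I ∈ latticeV := latticeV_shift hv (1) (0) (by push_cast; linear_combination (0) * hI)
    obtain ⟨e15, f15⟩ := corner_neg K hK _ (x + 1 + Complex.I) (x + 1 + Complex.I / 2) hv4 (by ring) (by right; ring)
    have hv5 : x + 3 / 2 - Complex.I ∈ latticeV := latticeV_shift hv (0) (-1) (by push_cast; linear_combination (1) * hI)
    obtain ⟨e16, f16⟩ := corner_neg K hK _ (x + 1 - Complex.I) (x + 1 - Complex.I / 2) hv5 (by ring) (by left; ring)
    obtain ⟨e17, f17⟩ := corner_neg K hK _ (x - 1 + Complex.I) (x - 1 + Complex.I / 2) hv2 (by ring) (by right; ring)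
    obtain ⟨e18, f18⟩ := corner_neg K hK _ (x - 1 - Complex.I) (x - 1 - Complex.I / 2) hv3 (by ring) (by left; ring)
    apply Complex.ext
    · simp only [Complex.add_re, Complex.add_im, Complex.mul_re, Complex.mul_im, Complex.re_ofNat, Complex.im_ofNat]
      linarith
    · simp only [Complex.add_re, Complex.add_im, Complex.mul_re, Complex.mul_im, Complex.re_ofNat, Complex.im_ofNat]
      linarith
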